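/- Let (φ_k) and (ψ_k) be sequences of analytic functions on the unit disk, uniformly bounded by M, converging uniformly on compact subsets to φ and ψ respectively, with ψ ≠ 0 a.e. on an arc I of the unit circle (in terms of nontangential boundary values). If the boundary-value quotients φ_k/ψ_k converge a.e. on I to a measurable function F, then F = φ/ψ a.e. on I. -/

import Mathlib

open MeasureTheory Filter Complex Real Set

/-- On a fixed finite measure, a uniformly bounded sequence whose integrals over all half-lines
tend to zero has integrals tending to zero over every measurable set. -/
lemma tendsto_setIntegral_zero_of_Iic {μ : Measure ℝ} [IsFiniteMeasure μ] {D : ℕ → ℝ → ℂ} {C : ℝ}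
    (hD : ∀ k, AEStronglyMeasurable (D k) μ) (hC : ∀ k, ∀ᵐ x ∂μ, ‖D k x‖ ≤ C)
    (huniv : Tendsto (fun k => ∫ x, D k x ∂μ) atTop (nhds 0))
    (hIic : ∀ c, Tendsto (fun k => ∫ x in Iic c, D k x ∂μ) atTop (nhds 0))
    {s : Set ℝ} (hs : MeasurableSet s) :
    Tendsto (fun k => ∫ x in s, D k x ∂μ) atTop (nhds 0) := by
  have hint : ∀ k, Integrable (D k) μ := fun k => Integrable.of_bound (hD k) C (hC k)
  induction s, hs using MeasurableSpace.induction_on_inter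
    (borel_eq_generateFrom_Iic ℝ ▸ BorelSpace.measurable_eq) isPiSystem_Iic with
  | empty => simp
  | basic t ht => obtain ⟨c, rfl⟩ := ht; exact hIic c
  | compl t ht ih =>
    have := huniv.sub ih
    rw [sub_zero] at this
    refine this.congr fun k => ?_
    rw [← integral_add_compl ht (hint k), add_sub_cancel_left]
  | iUnion t hdisj ht ih =>
    have h1 : ∀ k, ∫ x in ⋃ i, t i, D k x ∂μ = ∑' i, ∫ x in t i, D k x ∂μ := fun k =>
      integral_iUnion ht hdisj (hint k).integrableOn
    simp_rw [h1]
    have hsum : Summable fun i => C * μ.real (t i) := by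
      refine Summable.mul_left _ ?_
      exact ENNReal.summable_toReal (by rw [← measure_iUnion hdisj ht]; exact measure_ne_top _ _)
    have := tendsto_tsum_of_dominated_convergence (𝓕 := atTop)
      (f := fun k i => ∫ x in t i, D k x ∂μ) (g := fun _ => 0) hsum ih
      (Eventually.of_forall fun k i =>
        norm_setIntegral_le_of_norm_le_const_ae (measure_lt_top _ _)
          (ae_restrict_of_ae (hC k)))
    simpa using this

/-- A uniformly bounded sequence on a finite measure whose integrals over all half-lines tend to
zero converges to zero weakly against every integrable function. -/
lemma tendsto_integral_mul_zero_of_Iic {μ : Measure ℝ} [IsFiniteMeasure μ] {D : ℕ → ℝ → ℂ} {C : ℝ}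
    (hD : ∀ k, AEStronglyMeasurable (D k) μ) (hC : ∀ k, ∀ᵐ x ∂μ, ‖D k x‖ ≤ C)
    (huniv : Tendsto (fun k => ∫ x, D k x ∂μ) atTop (nhds 0))
    (hIic : ∀ c, Tendsto (fun k => ∫ x in Iic c, D k x ∂μ) atTop (nhds 0))
    {h : ℝ → ℂ} (hh : Integrable h μ) :
    Tendsto (fun k => ∫ x, h x * D k x ∂μ) atTop (nhds 0) := by
  have hmul : ∀ {g : ℝ → ℂ} (_ : Integrable g μ) k, Integrable (fun x => g x * D k x) μ :=
    fun hg k => hg.mul_bdd (hD k) (hC k)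
  refine Integrable.induction (μ := μ)
    (P := fun h => Tendsto (fun k => ∫ x, h x * D k x ∂μ) atTop (nhds 0)) ?_ ?_ ?_ ?_ hh
  · intro c s hs _
    have := (tendsto_setIntegral_zero_of_Iic hD hC huniv hIic hs).const_mul c
    rw [mul_zero] at this
    refine this.congr fun k => ?_
    rw [← integral_const_mul, ← integral_indicator hs]
    congr 1 with x
    by_cases hx : x ∈ s <;> simp [hx]
  · intro f g _ hf hg hfl hgl
    have := hfl.add hgl
    rw [add_zero] at this
    refine this.congr fun k => ?_
    rw [← integral_add (hmul hf k) (hmul hg k)]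
    simp only [Pi.add_apply, add_mul]
  · refine isClosed_of_closure_subset fun f hf => ?_
    rw [mem_ofPred_eq, Metric.tendsto_atTop]
    intro ε hε
    obtain ⟨g, hg, hfg⟩ := Metric.mem_closure_iff.1 hf (ε / (2 * (|C| + 1))) (by positivity)
    obtain ⟨N, hN⟩ := Metric.tendsto_atTop.1 hg (ε / 2) (by positivity)
    refine ⟨N, fun k hk => ?_⟩
    have hfi := L1.integrable_coeFn f
    have hgi := L1.integrable_coeFn g
    have h1 : ‖∫ x, (f x - g x) * D k x ∂μ‖ ≤ dist f g * (|C| + 1) := by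
      rw [dist_eq_norm, L1.norm_eq_integral_norm, ← integral_mul_const]
      refine norm_integral_le_of_norm_le ((L1.integrable_coeFn _).norm.mul_const _) ?_
      filter_upwards [hC k, Lp.coeFn_sub f g] with x hx hx'
      rw [hx', Pi.sub_apply, norm_mul]
      gcongr
      linarith [le_abs_self C]
    have h2 : ∫ x, f x * D k x ∂μ = ∫ x, (f x - g x) * D k x ∂μ + ∫ x, g x * D k x ∂μ := by
      have h := integral_add (hmul (hfi.sub hgi) k) (hmul hgi k)
      simp only [Pi.sub_apply] at h
      rw [← h]
      congr 1 with x
      ring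
    have h3 := hN k hk
    rw [dist_zero_right] at h3 ⊢
    have h4 : dist f g * (|C| + 1) < ε / 2 := by
      rw [lt_div_iff₀ (by positivity)] at hfg
      linarith
    rw [h2]
    exact (norm_add_le _ _).trans_lt (by linarith)
  · intro f g hfg _ hf
    refine hf.congr fun k => integral_congr_ae ?_
    filter_upwards [hfg] with x hx
    rw [hx]

lemma exp_mem_unitBall {x : ℝ} (hx : x < 0) (θ : ℝ) :
    Complex.exp (x + θ * I) ∈ Metric.ball (0 : ℂ) 1 := by
  simpa [Complex.norm_exp] using hx

/-- The integral of a bounded holomorphic function over an arc of a circle centred at the origin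
is Lipschitz in the logarithm of the radius, with a constant depending only on the bound. -/
lemma norm_arcIntegral_sub_le {f : ℂ → ℂ} {M : ℝ}
    (hf : DifferentiableOn ℂ f (Metric.ball 0 1)) (hM : ∀ z ∈ Metric.ball (0 : ℂ) 1, ‖f z‖ ≤ M)
    {x y : ℝ} (hx : x < 0) (hy : y < 0) (c d : ℝ) :
    ‖(∫ θ in c..d, f (Complex.exp (y + θ * I))) - ∫ θ in c..d, f (Complex.exp (x + θ * I))‖
      ≤ 2 * M * |y - x| := by
  have h := Complex.integral_boundary_rect_eq_zero_of_differentiableOn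
    (fun w => f (Complex.exp w)) (x + c * I) (y + d * I) (by
      refine hf.comp Complex.differentiable_exp.differentiableOn fun w hw => ?_
      have h1 : w.re ∈ uIcc x y := by simpa using hw.1
      have h2 : w.re < 0 := h1.2.trans_lt (max_lt hx hy)
      have := exp_mem_unitBall h2 w.im
      rwa [Complex.re_add_im] at this)
  simp only [add_re, ofReal_re, mul_re, I_re, mul_zero, ofReal_im, I_im, mul_one, sub_self,
    add_zero, add_im, mul_im, zero_add, smul_eq_mul] at h
  have hb : ∀ e : ℝ, ‖∫ s : ℝ in x..y, f (Complex.exp (s + e * I))‖ ≤ M * |y - x| := fun e =>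
    intervalIntegral.norm_integral_le_of_norm_le_const fun s hs =>
      hM _ (exp_mem_unitBall (hs.2.trans_lt (max_lt hx hy)) e)
  have h1 : I * ((∫ θ in c..d, f (Complex.exp (y + θ * I)))
      - ∫ θ in c..d, f (Complex.exp (x + θ * I)))
      = (∫ s : ℝ in x..y, f (Complex.exp (s + d * I)))
        - ∫ s : ℝ in x..y, f (Complex.exp (s + c * I)) := by
    linear_combination h
  calc _ = ‖I * ((∫ θ in c..d, f (Complex.exp (y + θ * I)))
      - ∫ θ in c..d, f (Complex.exp (x + θ * I)))‖ := by simp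
    _ ≤ _ := by rw [h1]; refine (norm_sub_le _ _).trans ?_; linarith [hb c, hb d]

lemma continuous_comp_exp_arc {f : ℂ → ℂ}
    (hf : DifferentiableOn ℂ f (Metric.ball 0 1)) {x : ℝ} (hx : x < 0) :
    Continuous fun θ : ℝ => f (Complex.exp (x + θ * I)) :=
  hf.continuousOn.comp_continuous (by fun_prop) (exp_mem_unitBall hx)

lemma tendsto_exp_arc_of_radial {f : ℂ → ℂ} {θ : ℝ} {w : ℂ}
    (h : Tendsto (fun t : ℝ => f ((t : ℂ) * Complex.exp ((θ : ℂ) * Complex.I)))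
      (nhdsWithin 1 (Iio 1)) (nhds w)) :
    Tendsto (fun x : ℝ => f (Complex.exp (x + θ * I))) (nhdsWithin 0 (Iio 0)) (nhds w) := by
  have h1 : Tendsto Real.exp (nhdsWithin 0 (Iio 0)) (nhdsWithin 1 (Iio 1)) := by
    refine tendsto_nhdsWithin_of_tendsto_nhds_of_eventually_within _ ?_ ?_
    · exact (Real.exp_zero ▸ Real.continuous_exp.tendsto 0).mono_left nhdsWithin_le_nhds
    · filter_upwards [self_mem_nhdsWithin] with x hx
      simpa using hx
  refine (h.comp h1).congr fun x => ?_
  simp [Complex.exp_add]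

section RadialLimit

variable {f : ℂ → ℂ} {Φ : ℝ → ℂ} {μ : Measure ℝ}

lemma aestronglyMeasurable_radialLimit (hf : DifferentiableOn ℂ f (Metric.ball 0 1))
    (hΦ : ∀ᵐ θ : ℝ ∂μ, Tendsto (fun t : ℝ => f ((t : ℂ) * Complex.exp ((θ : ℂ) * Complex.I)))
      (nhdsWithin 1 (Iio 1)) (nhds (Φ θ))) :
    AEStronglyMeasurable Φ μ := by
  have hlt : ∀ n : ℕ, -(1 / ((n : ℝ) + 1)) < 0 := fun n => neg_lt_zero.2 (by positivity)
  have hseq : Tendsto (fun n : ℕ => -(1 / ((n : ℝ) + 1))) atTop (nhdsWithin 0 (Iio 0)) := by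
    refine tendsto_nhdsWithin_of_tendsto_nhds_of_eventually_within _ ?_ (.of_forall hlt)
    simpa using tendsto_one_div_add_atTop_nhds_zero_nat (𝕜 := ℝ).neg
  refine aestronglyMeasurable_of_tendsto_ae atTop
    (f := fun (n : ℕ) (θ : ℝ) => f (Complex.exp ((-(1 / ((n : ℝ) + 1)) : ℝ) + θ * I)))
    (fun n => (continuous_comp_exp_arc hf (hlt n)).aestronglyMeasurable) ?_
  filter_upwards [hΦ] with θ hθ
  exact (tendsto_exp_arc_of_radial hθ).comp hseq

lemma norm_radialLimit_le {M : ℝ} (hM : ∀ z ∈ Metric.ball (0 : ℂ) 1, ‖f z‖ ≤ M)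
    (hΦ : ∀ᵐ θ : ℝ ∂μ, Tendsto (fun t : ℝ => f ((t : ℂ) * Complex.exp ((θ : ℂ) * Complex.I)))
      (nhdsWithin 1 (Iio 1)) (nhds (Φ θ))) :
    ∀ᵐ θ ∂μ, ‖Φ θ‖ ≤ M := by
  filter_upwards [hΦ] with θ hθ
  refine le_of_tendsto (tendsto_exp_arc_of_radial hθ).norm ?_
  filter_upwards [self_mem_nhdsWithin] with x hx
  exact hM _ (exp_mem_unitBall hx θ)

/-- The integral of the radial boundary values over an arc is approximated by the integrals over
smaller circles, at a rate depending only on the bound of the function. -/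
lemma norm_arcIntegral_radialLimit_sub_le {M : ℝ}
    (hf : DifferentiableOn ℂ f (Metric.ball 0 1)) (hM : ∀ z ∈ Metric.ball (0 : ℂ) 1, ‖f z‖ ≤ M)
    {c d : ℝ}
    (hΦ : ∀ᵐ θ : ℝ ∂(volume.restrict (uIoc c d)),
      Tendsto (fun t : ℝ => f ((t : ℂ) * Complex.exp ((θ : ℂ) * Complex.I)))
        (nhdsWithin 1 (Iio 1)) (nhds (Φ θ))) {x : ℝ} (hx : x < 0) :
    ‖(∫ θ in c..d, Φ θ) - ∫ θ in c..d, f (Complex.exp (x + θ * I))‖ ≤ 2 * M * |x| := by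
  have hlim : Tendsto (fun y : ℝ => ∫ θ in c..d, f (Complex.exp (y + θ * I)))
      (nhdsWithin 0 (Iio 0)) (nhds (∫ θ in c..d, Φ θ)) := by
    refine intervalIntegral.tendsto_integral_filter_of_dominated_convergence (fun _ => M)
      ?_ ?_ intervalIntegrable_const ?_
    · filter_upwards [self_mem_nhdsWithin] with y hy
      exact (continuous_comp_exp_arc hf hy).aestronglyMeasurable
    · filter_upwards [self_mem_nhdsWithin] with y hy
      exact .of_forall fun θ _ => hM _ (exp_mem_unitBall hy θ)
    · filter_upwards [(ae_restrict_iff' measurableSet_uIoc).1 hΦ] with θ hθ hmem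
      exact tendsto_exp_arc_of_radial (hθ hmem)
  have habs : Tendsto (fun y : ℝ => 2 * M * |y - x|) (nhdsWithin 0 (Iio 0))
      (nhds (2 * M * |x|)) := by
    have : Continuous fun y : ℝ => 2 * M * |y - x| := by fun_prop
    simpa using (this.tendsto 0).mono_left (nhdsWithin_le_nhds (s := Iio 0))
  refine le_of_tendsto_of_tendsto (hlim.sub_const _).norm habs ?_
  filter_upwards [self_mem_nhdsWithin] with y hy
  exact norm_arcIntegral_sub_le hf hM hx hy c d

end RadialLimit

/-- Arc integrals of radial boundary values are continuous under pointwise convergence of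
uniformly bounded holomorphic functions on the disc. -/
lemma tendsto_arcIntegral_radialLimit {fs : ℕ → ℂ → ℂ} {f : ℂ → ℂ} {Φs : ℕ → ℝ → ℂ} {Φ : ℝ → ℂ}
    {M : ℝ} (hfs : ∀ k, DifferentiableOn ℂ (fs k) (Metric.ball 0 1))
    (hf : DifferentiableOn ℂ f (Metric.ball 0 1))
    (hMs : ∀ k, ∀ z ∈ Metric.ball (0 : ℂ) 1, ‖fs k z‖ ≤ M)
    (hM : ∀ z ∈ Metric.ball (0 : ℂ) 1, ‖f z‖ ≤ M)
    (hconv : ∀ z ∈ Metric.ball (0 : ℂ) 1, Tendsto (fun k => fs k z) atTop (nhds (f z)))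
    {c d : ℝ}
    (hΦs : ∀ k, ∀ᵐ θ : ℝ ∂(volume.restrict (uIoc c d)),
      Tendsto (fun t : ℝ => fs k ((t : ℂ) * Complex.exp ((θ : ℂ) * Complex.I)))
        (nhdsWithin 1 (Iio 1)) (nhds (Φs k θ)))
    (hΦ : ∀ᵐ θ : ℝ ∂(volume.restrict (uIoc c d)),
      Tendsto (fun t : ℝ => f ((t : ℂ) * Complex.exp ((θ : ℂ) * Complex.I)))
        (nhdsWithin 1 (Iio 1)) (nhds (Φ θ))) :
    Tendsto (fun k => ∫ θ in c..d, Φs k θ) atTop (nhds (∫ θ in c..d, Φ θ)) := by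
  have hM0 : 0 ≤ M := (norm_nonneg _).trans (hM 0 (by simp))
  rw [Metric.tendsto_atTop]
  intro ε hε
  obtain ⟨x, hx, hxε⟩ : ∃ x : ℝ, x < 0 ∧ 2 * M * |x| < ε / 3 := by
    refine ⟨-(ε / (6 * (M + 1))), neg_lt_zero.2 (by positivity), ?_⟩
    rw [abs_neg, abs_of_pos (by positivity), ← mul_div_assoc, div_lt_div_iff₀ (by positivity)
      (by positivity)]
    nlinarith
  have hmid : Tendsto (fun k => ∫ θ in c..d, fs k (Complex.exp (x + θ * I))) atTop
      (nhds (∫ θ in c..d, f (Complex.exp (x + θ * I)))) :=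
    intervalIntegral.tendsto_integral_filter_of_dominated_convergence (fun _ => M)
      (.of_forall fun k => (continuous_comp_exp_arc (hfs k) hx).aestronglyMeasurable)
      (.of_forall fun k => .of_forall fun θ _ => hMs k _ (exp_mem_unitBall hx θ))
      intervalIntegrable_const
      (.of_forall fun θ _ => hconv _ (exp_mem_unitBall hx θ))
  obtain ⟨N, hN⟩ := Metric.tendsto_atTop.1 hmid (ε / 3) (by positivity)
  refine ⟨N, fun k hk => ?_⟩
  have h1 := norm_arcIntegral_radialLimit_sub_le (hfs k) (hMs k) (hΦs k) hx
  have h2 := norm_arcIntegral_radialLimit_sub_le hf hM hΦ hx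
  have h3 := hN k hk
  rw [← dist_eq_norm] at h1 h2
  rw [dist_comm] at h2
  refine (dist_triangle4 _ _ _ _).trans_lt (add_lt_add_of_lt_of_le
    (add_lt_add_of_le_of_lt h1 h3) h2 |>.trans ?_)
  linarith

/-- A lower bound from Jensen's formula: the circle averages of `log ‖f‖` are bounded below for
radii in `[1/2, 1)`. -/
lemma exists_le_circleAverage_log_norm {f : ℂ → ℂ} (hf : AnalyticOnNhd ℂ f (Metric.ball 0 1)) :
    ∃ L : ℝ, ∀ r : ℝ, 1 / 2 ≤ r → r < 1 → L ≤ circleAverage (Real.log ‖f ·‖) 0 r := by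
  refine ⟨((meromorphicOrderAt f 0).untop₀ : ℝ) * Real.log (1 / 2)
    + Real.log ‖meromorphicTrailingCoeffAt f 0‖, fun r hr hr1 => ?_⟩
  have hr0 : 0 < r := by linarith
  have han : AnalyticOnNhd ℂ f (Metric.closedBall 0 |r|) :=
    hf.mono (Metric.closedBall_subset_ball (by rwa [abs_of_pos hr0]))
  have hdiv := MeromorphicOn.AnalyticOnNhd.divisor_nonneg han
  rw [MeromorphicOn.circleAverage_log_norm hr0.ne' han.meromorphicOn]
  have hsum : 0 ≤ ∑ᶠ u, (MeromorphicOn.divisor f (Metric.closedBall 0 |r|) u : ℝ)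
      * Real.log (r * ‖0 - u‖⁻¹) := by
    refine finsum_nonneg fun u => ?_
    by_cases hu : u ∈ Metric.closedBall (0 : ℂ) |r|
    · refine mul_nonneg (by exact_mod_cast hdiv u) ?_
      rcases eq_or_ne u 0 with rfl | hu0
      · simp
      · refine Real.log_nonneg ?_
        rw [mem_closedBall_zero_iff, abs_of_pos hr0] at hu
        rw [zero_sub, norm_neg, ← div_eq_mul_inv]
        exact (one_le_div (norm_pos_iff.2 hu0)).2 hu
    · simp [hu]
  have h0 : (0 : ℂ) ∈ Metric.closedBall (0 : ℂ) |r| := by simp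
  have hd0 := hdiv 0
  rw [MeromorphicOn.divisor_apply han.meromorphicOn h0] at hd0 ⊢
  have hd0' : (0 : ℝ) ≤ ((meromorphicOrderAt f 0).untop₀ : ℝ) := by exact_mod_cast hd0
  have := mul_le_mul_of_nonneg_left (Real.log_le_log (by norm_num) hr) hd0'
  linarith

/-- The Riesz uniqueness theorem on an arc of length `2 * π`. -/
lemma ae_not_tendsto_radial_zero_Ioc {f : ℂ → ℂ} {M : ℝ}
    (hf : DifferentiableOn ℂ f (Metric.ball 0 1)) (hM : ∀ z ∈ Metric.ball (0 : ℂ) 1, ‖f z‖ ≤ M)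
    {z₀ : ℂ} (hz₀ : z₀ ∈ Metric.ball (0 : ℂ) 1) (hfz₀ : f z₀ ≠ 0) (η : ℝ) :
    ∀ᵐ θ : ℝ ∂(volume.restrict (Ioc η (η + 2 * π))),
      ¬ Tendsto (fun t : ℝ => f ((t : ℂ) * Complex.exp ((θ : ℂ) * Complex.I)))
        (nhdsWithin 1 (Iio 1)) (nhds 0) := by
  have han : AnalyticOnNhd ℂ f (Metric.ball 0 1) := hf.analyticOnNhd Metric.isOpen_ball
  obtain ⟨L, hL⟩ := exists_le_circleAverage_log_norm han
  set r : ℕ → ℝ := fun n => 1 - 1 / ((n : ℝ) + 2) with hr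
  have hrhalf : ∀ n, 1 / 2 ≤ r n := fun n => by
    have : 1 / ((n : ℝ) + 2) ≤ 1 / 2 := by gcongr; linarith [n.cast_nonneg (α := ℝ)]
    simp only [hr]; linarith
  have hr1 : ∀ n, r n < 1 := fun n => by
    have : 0 < 1 / ((n : ℝ) + 2) := by positivity
    simp only [hr]; linarith
  have hr0 : ∀ n, 0 < r n := fun n => by linarith [hrhalf n]
  have hrlim : Tendsto r atTop (nhdsWithin 1 (Iio 1)) := by
    refine tendsto_nhdsWithin_of_tendsto_nhds_of_eventually_within _ ?_ (.of_forall hr1)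
    have := (tendsto_const_div_atTop_nhds_zero_nat (1 : ℝ)).comp (tendsto_add_atTop_nat 2)
    simpa [hr, Function.comp_def] using this.const_sub 1
  have hmem : ∀ n θ, circleMap 0 (r n) θ ∈ Metric.ball (0 : ℂ) 1 := fun n θ => by
    simpa [circleMap, abs_of_pos (hr0 n)] using hr1 n
  set K : ℝ := Real.log (max M 1) with hK
  have hle : ∀ z ∈ Metric.ball (0 : ℂ) 1, 0 ≤ K - Real.log ‖f z‖ := fun z hz => by
    rcases eq_or_ne (f z) 0 with h | h
    · simp [h, hK, Real.log_nonneg]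
    · exact sub_nonneg.2 (Real.log_le_log (norm_pos_iff.2 h) ((hM z hz).trans (le_max_left _ _)))
  have hper : η ≤ η + 2 * π := by linarith [Real.two_pi_pos]
  have hsph : ∀ n, Metric.sphere (0 : ℂ) |r n| ⊆ Metric.ball 0 1 := fun n =>
    Metric.sphere_subset_closedBall.trans
      (Metric.closedBall_subset_ball (by rw [abs_of_pos (hr0 n)]; exact hr1 n))
  have hlogint : ∀ n, IntegrableOn (fun θ => Real.log ‖f (circleMap 0 (r n) θ)‖)
      (Ioc η (η + 2 * π)) volume := fun n => by
    have h1 : CircleIntegrable (Real.log ‖f ·‖) 0 (r n) :=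
      MeromorphicOn.circleIntegrable_log_norm (han.mono (hsph n)).meromorphicOn
    have h2 : Function.Periodic (fun θ => Real.log ‖f (circleMap 0 (r n) θ)‖) (2 * π) :=
      fun θ => by simp [periodic_circleMap 0 (r n) θ]
    rw [← intervalIntegrable_iff_integrableOn_Ioc_of_le hper]
    exact h2.intervalIntegrable₀ Real.two_pi_pos.ne' h1 _ _
  have hlogavg : ∀ n, ∫ θ in Ioc η (η + 2 * π), Real.log ‖f (circleMap 0 (r n) θ)‖
      = 2 * π * circleAverage (Real.log ‖f ·‖) 0 (r n) := fun n => by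
    have h2 : Function.Periodic (fun θ => Real.log ‖f (circleMap 0 (r n) θ)‖) (2 * π) :=
      fun θ => by simp [periodic_circleMap 0 (r n) θ]
    rw [← intervalIntegral.integral_of_le hper, h2.intervalIntegral_add_eq η 0, zero_add,
      circleAverage_def, smul_eq_mul, mul_inv_cancel_left₀ Real.two_pi_pos.ne']
  set u : ℕ → ℝ → ENNReal := fun n θ => ENNReal.ofReal (K - Real.log ‖f (circleMap 0 (r n) θ)‖)
  have huint : ∀ n, ∫⁻ θ in Ioc η (η + 2 * π), u n θ ≤ ENNReal.ofReal (2 * π * (K - L)) := by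
    intro n
    have hi : IntegrableOn (fun θ => K - Real.log ‖f (circleMap 0 (r n) θ)‖)
      (Ioc η (η + 2 * π)) volume := (integrable_const K).sub (hlogint n)
    rw [← ofReal_integral_eq_lintegral_ofReal hi (.of_forall fun θ => hle _ (hmem n θ))]
    refine ENNReal.ofReal_le_ofReal ?_
    rw [integral_sub (integrable_const K) (hlogint n), hlogavg n]
    have h3 := mul_le_mul_of_nonneg_left (hL (r n) (hrhalf n) (hr1 n)) Real.two_pi_pos.le
    simp [Real.two_pi_pos.le]
    linarith
  have humeas : ∀ n, Measurable (u n) := fun n =>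
    ((Real.measurable_log.comp (hf.continuousOn.comp_continuous (continuous_circleMap 0 (r n))
      (hmem n)).norm.measurable).const_sub K).ennreal_ofReal
  have hfin : ∫⁻ θ in Ioc η (η + 2 * π), liminf (fun n => u n θ) atTop ≠ ⊤ := by
    refine ((lintegral_liminf_le humeas).trans ?_).trans_lt
      (ENNReal.ofReal_lt_top (r := 2 * π * (K - L))) |>.ne
    exact liminf_le_of_frequently_le' (.of_forall huint)
  have hlt := ae_lt_top (.liminf humeas) hfin
  have hne : ∀ᵐ θ ∂(volume.restrict (Ioc η (η + 2 * π))),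
      ∀ n, f (circleMap 0 (r n) θ) ≠ 0 := by
    refine ae_all_iff.2 fun n => ?_
    have h1 : f ⁻¹' {0}ᶜ ∈ codiscreteWithin (Metric.ball (0 : ℂ) 1) :=
      han.preimage_zero_mem_codiscreteWithin hfz₀ hz₀
        ⟨⟨z₀, hz₀⟩, (convex_ball (0 : ℂ) 1).isPreconnected⟩
    have h2 := circleMap_preimage_codiscrete (c := 0) (hr0 n).ne'
      (codiscreteWithin_mono (hsph n) h1)
    exact ae_restrict_le_codiscreteWithin measurableSet_Ioc
      (codiscreteWithin_mono (subset_univ _) h2)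
  filter_upwards [hlt, hne] with θ hθ hθne hlim
  refine hθ.ne (Tendsto.liminf_eq ?_)
  have h1 : Tendsto (fun n => ‖f (circleMap 0 (r n) θ)‖) atTop (nhdsWithin 0 (Ioi 0)) := by
    refine tendsto_nhdsWithin_of_tendsto_nhds_of_eventually_within _ ?_
      (.of_forall fun n => norm_pos_iff.2 (hθne n))
    simpa [circleMap, Function.comp_def] using (hlim.comp hrlim).norm
  refine ENNReal.tendsto_ofReal_atTop.comp ?_
  exact tendsto_atTop_add_const_left _ K
    (tendsto_neg_atBot_atTop.comp (Real.tendsto_log_nhdsGT_zero.comp h1)) |>.congr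
      fun n => by simp [sub_eq_add_neg]

/-- The Riesz uniqueness theorem: a bounded holomorphic function on the disc that does not vanish
identically has radial limit zero almost nowhere. -/
lemma ae_not_tendsto_radial_zero {f : ℂ → ℂ} {M : ℝ}
    (hf : DifferentiableOn ℂ f (Metric.ball 0 1)) (hM : ∀ z ∈ Metric.ball (0 : ℂ) 1, ‖f z‖ ≤ M)
    {z₀ : ℂ} (hz₀ : z₀ ∈ Metric.ball (0 : ℂ) 1) (hfz₀ : f z₀ ≠ 0) :
    ∀ᵐ θ : ℝ, ¬ Tendsto (fun t : ℝ => f ((t : ℂ) * Complex.exp ((θ : ℂ) * Complex.I)))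
        (nhdsWithin 1 (Iio 1)) (nhds 0) := by
  rw [← Measure.restrict_univ (μ := volume), ← iUnion_Ioc_zsmul Real.two_pi_pos,
    ae_restrict_iUnion_iff]
  intro n
  rw [add_smul, one_smul]
  exact ae_not_tendsto_radial_zero_Ioc hf hM hz₀ hfz₀ _

/-- Radial boundary values of uniformly bounded, locally uniformly convergent holomorphic functions
converge weakly on an arc. -/
lemma tendsto_integral_mul_radialLimit_sub {a b M : ℝ} (hab : a ≤ b) {fs : ℕ → ℂ → ℂ} {f : ℂ → ℂ}
    {Φs : ℕ → ℝ → ℂ} {Φ : ℝ → ℂ}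
    (hfs : ∀ k, DifferentiableOn ℂ (fs k) (Metric.ball 0 1))
    (hMs : ∀ k, ∀ z ∈ Metric.ball (0 : ℂ) 1, ‖fs k z‖ ≤ M)
    (hconv : TendstoLocallyUniformlyOn fs f atTop (Metric.ball (0 : ℂ) 1))
    (hΦs : ∀ k, ∀ᵐ θ : ℝ ∂(volume.restrict (Ioo a b)),
      Tendsto (fun t : ℝ => fs k ((t : ℂ) * Complex.exp ((θ : ℂ) * Complex.I)))
        (nhdsWithin 1 (Iio 1)) (nhds (Φs k θ)))
    (hΦ : ∀ᵐ θ : ℝ ∂(volume.restrict (Ioo a b)),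
      Tendsto (fun t : ℝ => f ((t : ℂ) * Complex.exp ((θ : ℂ) * Complex.I)))
        (nhdsWithin 1 (Iio 1)) (nhds (Φ θ)))
    {h : ℝ → ℂ} (hh : IntegrableOn h (Ioo a b)) :
    Tendsto (fun k => ∫ θ in Ioo a b, h θ * (Φs k θ - Φ θ)) atTop (nhds 0) := by
  have hf : DifferentiableOn ℂ f (Metric.ball 0 1) :=
    hconv.differentiableOn (.of_forall hfs) Metric.isOpen_ball
  have hpt : ∀ z ∈ Metric.ball (0 : ℂ) 1, Tendsto (fun k => fs k z) atTop (nhds (f z)) :=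
    fun z hz => hconv.tendsto_at hz
  have hM : ∀ z ∈ Metric.ball (0 : ℂ) 1, ‖f z‖ ≤ M := fun z hz =>
    le_of_tendsto (hpt z hz).norm (.of_forall fun k => hMs k z hz)
  have hmeas := aestronglyMeasurable_radialLimit hf hΦ
  have hmeass := fun k => aestronglyMeasurable_radialLimit (hfs k) (hΦs k)
  have hbd := norm_radialLimit_le hM hΦ
  have hbds := fun k => norm_radialLimit_le (hMs k) (hΦs k)
  have hint : IntegrableOn Φ (Ioo a b) := Integrable.of_bound hmeas M hbd
  have hints : ∀ k, IntegrableOn (Φs k) (Ioo a b) := fun k =>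
    Integrable.of_bound (hmeass k) M (hbds k)
  have harc : ∀ c, a ≤ c → c ≤ b →
      Tendsto (fun k => ∫ θ in Ioo a c, (Φs k θ - Φ θ)) atTop (nhds 0) := by
    intro c hac hcb
    have hrestr : volume.restrict (uIoc a c) ≤ volume.restrict (Ioo a b) := by
      rw [uIoc_of_le hac, ← restrict_Ioo_eq_restrict_Ioc]
      exact Measure.restrict_mono (Ioo_subset_Ioo_right hcb) le_rfl
    have hsub : Ioo a c ⊆ Ioo a b := Ioo_subset_Ioo_right hcb
    have := (tendsto_arcIntegral_radialLimit hfs hf hMs hM hpt (c := a) (d := c)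
      (fun k => ae_mono hrestr (hΦs k)) (ae_mono hrestr hΦ)).sub_const (∫ θ in a..c, Φ θ)
    rw [sub_self] at this
    refine this.congr fun k => ?_
    rw [intervalIntegral.integral_of_le hac, intervalIntegral.integral_of_le hac,
      integral_Ioc_eq_integral_Ioo, integral_Ioc_eq_integral_Ioo,
      integral_sub ((hints k).mono_set hsub) (hint.mono_set hsub)]
  refine tendsto_integral_mul_zero_of_Iic (D := fun k θ => Φs k θ - Φ θ) (C := M + M)
    (fun k => (hmeass k).sub hmeas) (fun k => ?_) (harc b hab le_rfl) (fun c => ?_) hh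
  · filter_upwards [hbd, hbds k] with θ h1 h2
    exact (norm_sub_le _ _).trans (add_le_add h2 h1)
  · refine (harc (max a (min b c)) (le_max_left _ _)
      (max_le hab (min_le_left _ _))).congr fun k => ?_
    rw [Measure.restrict_restrict measurableSet_Iic]
    refine setIntegral_congr_set ?_
    have hne : ∀ᵐ θ : ℝ, θ ≠ c := by simp [ae_iff]
    filter_upwards [hne] with θ hθ
    refine propext ?_
    change θ ∈ Ioo a (max a (min b c)) ↔ θ ∈ Iic c ∩ Ioo a b
    simp only [mem_Ioo, mem_inter_iff, mem_Iic, lt_max_iff, lt_min_iff]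
    have := lt_iff_le_and_ne (a := θ) (b := c)
    have := lt_asymm (a := a) (b := θ)
    tauto

/-- Let `(φ_k)`, `(ψ_k)` be analytic on the unit disk, uniformly
bounded by `M`, converging locally uniformly to `φ`, `ψ`. Let
`Φ_k, Ψ_k, Φ, Ψ` denote their radial boundary values on an arc
`I = {e^{iθ} : θ ∈ (a,b)}`, existing a.e. on `I`, with `Ψ ≠ 0` a.e. on `I`.
If the quotients `Φ_k/Ψ_k` converge a.e. on `I` to a measurable function `F`,
then `F = Φ/Ψ` a.e. on `I`. -/
theorem stmt_18 (a b : ℝ) (hab : a < b) (M : ℝ)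
    (φs ψs : ℕ → ℂ → ℂ) (φ ψ : ℂ → ℂ)
    (hφdiff : ∀ k, DifferentiableOn ℂ (φs k) (Metric.ball (0 : ℂ) 1))
    (hψdiff : ∀ k, DifferentiableOn ℂ (ψs k) (Metric.ball (0 : ℂ) 1))
    (hφbd : ∀ k, ∀ z ∈ Metric.ball (0 : ℂ) 1, ‖φs k z‖ ≤ M)
    (hψbd : ∀ k, ∀ z ∈ Metric.ball (0 : ℂ) 1, ‖ψs k z‖ ≤ M)
    (hφconv : TendstoLocallyUniformlyOn φs φ atTop (Metric.ball (0 : ℂ) 1))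
    (hψconv : TendstoLocallyUniformlyOn ψs ψ atTop (Metric.ball (0 : ℂ) 1))
    (Φs Ψs : ℕ → ℝ → ℂ) (Φ Ψ F : ℝ → ℂ) (hF : Measurable F)
    (hΦs : ∀ k, ∀ᵐ θ : ℝ ∂(volume.restrict (Set.Ioo a b)),
      Tendsto (fun t : ℝ => φs k ((t : ℂ) * Complex.exp ((θ : ℂ) * Complex.I)))
        (nhdsWithin 1 (Set.Iio 1)) (nhds (Φs k θ)))
    (hΨs : ∀ k, ∀ᵐ θ : ℝ ∂(volume.restrict (Set.Ioo a b)),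
      Tendsto (fun t : ℝ => ψs k ((t : ℂ) * Complex.exp ((θ : ℂ) * Complex.I)))
        (nhdsWithin 1 (Set.Iio 1)) (nhds (Ψs k θ)))
    (hΦ : ∀ᵐ θ : ℝ ∂(volume.restrict (Set.Ioo a b)),
      Tendsto (fun t : ℝ => φ ((t : ℂ) * Complex.exp ((θ : ℂ) * Complex.I)))
        (nhdsWithin 1 (Set.Iio 1)) (nhds (Φ θ)))
    (hΨ : ∀ᵐ θ : ℝ ∂(volume.restrict (Set.Ioo a b)),
      Tendsto (fun t : ℝ => ψ ((t : ℂ) * Complex.exp ((θ : ℂ) * Complex.I)))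
        (nhdsWithin 1 (Set.Iio 1)) (nhds (Ψ θ)))
    (hΨne : ∀ᵐ θ : ℝ ∂(volume.restrict (Set.Ioo a b)), Ψ θ ≠ 0)
    (hquot : ∀ᵐ θ : ℝ ∂(volume.restrict (Set.Ioo a b)),
      Tendsto (fun k : ℕ => Φs k θ / Ψs k θ) atTop (nhds (F θ))) :
    ∀ᵐ θ : ℝ ∂(volume.restrict (Set.Ioo a b)), F θ = Φ θ / Ψ θ := by
  have hφpt : ∀ z ∈ Metric.ball (0 : ℂ) 1, Tendsto (fun k => φs k z) atTop (nhds (φ z)) :=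
    fun z hz => hφconv.tendsto_at hz
  have hψpt : ∀ z ∈ Metric.ball (0 : ℂ) 1, Tendsto (fun k => ψs k z) atTop (nhds (ψ z)) :=
    fun z hz => hψconv.tendsto_at hz
  have hφd := hφconv.differentiableOn (.of_forall hφdiff) Metric.isOpen_ball
  have hψd := hψconv.differentiableOn (.of_forall hψdiff) Metric.isOpen_ball
  have hφM : ∀ z ∈ Metric.ball (0 : ℂ) 1, ‖φ z‖ ≤ M := fun z hz =>
    le_of_tendsto (hφpt z hz).norm (.of_forall fun k => hφbd k z hz)
  have hψM : ∀ z ∈ Metric.ball (0 : ℂ) 1, ‖ψ z‖ ≤ M := fun z hz =>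
    le_of_tendsto (hψpt z hz).norm (.of_forall fun k => hψbd k z hz)
  have hM0 : 0 ≤ M := (norm_nonneg _).trans (hφM 0 (by simp))
  have hΦm := aestronglyMeasurable_radialLimit hφd hΦ
  have hΨm := aestronglyMeasurable_radialLimit hψd hΨ
  have hΦsm := fun k => aestronglyMeasurable_radialLimit (hφdiff k) (hΦs k)
  have hΨsm := fun k => aestronglyMeasurable_radialLimit (hψdiff k) (hΨs k)
  have hΦb := norm_radialLimit_le hφM hΦ
  have hΨb := norm_radialLimit_le hψM hΨ
  have hΦsb := fun k => norm_radialLimit_le (hφbd k) (hΦs k)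
  have hΨsb := fun k => norm_radialLimit_le (hψbd k) (hΨs k)
  -- `ψ` is not identically zero, so `Ψs k` is nonzero almost everywhere for large `k`.
  obtain ⟨z₀, hz₀, hψz₀⟩ : ∃ z ∈ Metric.ball (0 : ℂ) 1, ψ z ≠ 0 := by
    by_contra! hzero
    have : NeBot (ae (volume.restrict (Ioo a b))) := by
      rw [ae_neBot, Ne, Measure.restrict_eq_zero, Real.volume_Ioo]
      simpa using hab
    obtain ⟨θ, hθ, hθne⟩ := (hΨ.and hΨne).exists
    refine hθne (tendsto_nhds_unique (tendsto_exp_arc_of_radial hθ) ?_)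
    refine tendsto_const_nhds.congr' ?_
    filter_upwards [self_mem_nhdsWithin] with x hx
    exact (hzero _ (exp_mem_unitBall hx θ)).symm
  have hΨsne : ∀ᵐ θ : ℝ ∂(volume.restrict (Ioo a b)), ∀ᶠ k in atTop, Ψs k θ ≠ 0 := by
    have h1 : ∀ᵐ θ : ℝ ∂(volume.restrict (Ioo a b)), ∀ k, ψs k z₀ ≠ 0 → Ψs k θ ≠ 0 := by
      refine ae_all_iff.2 fun k => ?_
      by_cases hk : ψs k z₀ = 0
      · simp [hk]
      · filter_upwards [hΨs k, ae_restrict_of_ae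
          (ae_not_tendsto_radial_zero (hψdiff k) (hψbd k) hz₀ hk)] with θ h2 h3 _ h4
        exact h3 (h4 ▸ h2)
    filter_upwards [h1] with θ hθ
    exact ((hψpt z₀ hz₀).eventually_ne hψz₀).mono fun k => hθ k
  have hD : ∀ᵐ θ : ℝ ∂(volume.restrict (Ioo a b)),
      Tendsto (fun k => Φs k θ - F θ * Ψs k θ) atTop (nhds 0) := by
    filter_upwards [hquot, hΨsne, ae_all_iff.2 hΨsb] with θ hq hne hb
    have h1 : Tendsto (fun k => (Φs k θ / Ψs k θ - F θ) * Ψs k θ) atTop (nhds 0) := by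
      refine Tendsto.zero_mul_isBoundedUnder_le (by simpa using hq.sub_const (F θ)) ?_
      exact isBoundedUnder_of ⟨M, hb⟩
    refine h1.congr' ?_
    filter_upwards [hne] with k hk
    rw [sub_mul, div_mul_cancel₀ _ hk]
  have hzero : ∀ N : ℕ, ∀ᵐ θ : ℝ ∂(volume.restrict (Ioo a b)),
      ‖F θ‖ ≤ N → Φ θ - F θ * Ψ θ = 0 := by
    intro N
    have hA : MeasurableSet {θ | ‖F θ‖ ≤ N} := measurableSet_le hF.norm measurable_const
    set A := {θ | ‖F θ‖ ≤ N}
    have hbound : ∀ {θ : ℝ} {p q : ℂ}, ‖p‖ ≤ M → ‖q‖ ≤ M →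
        ‖A.indicator (fun θ => p - F θ * q) θ‖ ≤ M + N * M := by
      intro θ p q hp hq
      by_cases hθ : θ ∈ A
      · rw [indicator_of_mem hθ]
        refine (norm_sub_le _ _).trans (add_le_add hp ?_)
        rw [norm_mul]
        exact mul_le_mul hθ hq (norm_nonneg _) N.cast_nonneg
      · rw [indicator_of_notMem hθ, norm_zero]
        positivity
    have hGint : IntegrableOn (A.indicator fun θ => Φ θ - F θ * Ψ θ) (Ioo a b) := by
      refine Integrable.of_bound
        ((hΦm.sub (hF.aestronglyMeasurable.mul hΨm)).indicator hA) (M + N * M) ?_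
      filter_upwards [hΦb, hΨb] with θ h1 h2
      exact hbound h1 h2
    have hGsint : ∀ k, IntegrableOn (A.indicator fun θ => Φs k θ - F θ * Ψs k θ) (Ioo a b) := by
      intro k
      refine Integrable.of_bound
        (((hΦsm k).sub (hF.aestronglyMeasurable.mul (hΨsm k))).indicator hA) (M + N * M) ?_
      filter_upwards [hΦsb k, hΨsb k] with θ h1 h2
      exact hbound h1 h2
    have hG := hGint.ae_eq_zero_of_forall_setIntegral_eq_zero fun s hs _ => ?_
    · filter_upwards [hG] with θ hθ hmem
      have : θ ∈ A := hmem
      simpa [this] using hθ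
    have hlim1 : Tendsto (fun k => ∫ θ in s, A.indicator (fun θ => Φs k θ - F θ * Ψs k θ) θ
        ∂(volume.restrict (Ioo a b))) atTop (nhds 0) := by
      have := tendsto_integral_of_dominated_convergence
        (μ := (volume.restrict (Ioo a b)).restrict s) (f := fun _ => (0 : ℂ))
        (F := fun k => A.indicator fun θ => Φs k θ - F θ * Ψs k θ) (fun _ => M + N * M)
        (fun k => (hGsint k).aestronglyMeasurable.restrict) (integrable_const _)
        (fun k => ?_) ?_
      · simpa using this
      · refine ae_restrict_of_ae ?_
        filter_upwards [hΦsb k, hΨsb k] with θ h1 h2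
        exact hbound h1 h2
      · refine ae_restrict_of_ae ?_
        filter_upwards [hD] with θ hθ
        by_cases hmem : θ ∈ A <;> simp [hmem, hθ]
    set h : ℝ → ℂ := (s ∩ A).indicator 1 with hh
    have hhm : Measurable h := measurable_one.indicator (hs.inter hA)
    have hhint : IntegrableOn h (Ioo a b) :=
      (integrable_const (1 : ℂ)).indicator (hs.inter hA)
    have hFhint : IntegrableOn (fun θ => h θ * F θ) (Ioo a b) := by
      refine Integrable.of_bound (hhm.mul hF).aestronglyMeasurable N (.of_forall fun θ => ?_)
      by_cases hmem : θ ∈ s ∩ A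
      · have : ‖F θ‖ ≤ N := hmem.2
        simpa only [hh, indicator_of_mem hmem, Pi.one_apply, one_mul] using this
      · simp [hh, hmem]
    have hw1 := tendsto_integral_mul_radialLimit_sub hab.le hφdiff hφbd hφconv hΦs hΦ hhint
    have hw2 := tendsto_integral_mul_radialLimit_sub hab.le hψdiff hψbd hψconv hΨs hΨ hFhint
    have hlim2 : Tendsto (fun k => (∫ θ in s, A.indicator (fun θ => Φs k θ - F θ * Ψs k θ) θ
        ∂(volume.restrict (Ioo a b))) - ∫ θ in s, A.indicator (fun θ => Φ θ - F θ * Ψ θ) θ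
        ∂(volume.restrict (Ioo a b))) atTop (nhds 0) := by
      have := hw1.sub hw2
      rw [sub_zero] at this
      refine this.congr fun k => ?_
      have hsplit := integral_sub ((hGsint k).integrable.restrict (s := s))
        (hGint.integrable.restrict (s := s))
      rw [← hsplit, ← integral_indicator hs, ← integral_sub]
      · refine integral_congr_ae (.of_forall fun θ => ?_)
        by_cases h1 : θ ∈ s <;> by_cases h2 : θ ∈ A <;> simp [hh, h1, h2]
        ring
      · refine hhint.mul_bdd (c := M + M) ((hΦsm k).sub hΦm) ?_
        filter_upwards [hΦsb k, hΦb] with θ h1 h2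
        exact (norm_sub_le _ _).trans (add_le_add h1 h2)
      · refine hFhint.mul_bdd (c := M + M) ((hΨsm k).sub hΨm) ?_
        filter_upwards [hΨsb k, hΨb] with θ h1 h2
        exact (norm_sub_le _ _).trans (add_le_add h1 h2)
    have := tendsto_nhds_unique hlim2 (hlim1.sub_const _)
    rw [zero_sub, eq_comm, neg_eq_zero] at this
    exact this
  filter_upwards [ae_all_iff.2 hzero, hΨne] with θ hθ hne
  obtain ⟨N, hN⟩ := exists_nat_ge ‖F θ‖
  rw [eq_div_iff hne]
  exact (sub_eq_zero.1 (hθ N hN)).symm
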